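/- arXiv:1705.09059 — 2 statements merged into one kernel-verified Lean document; each statement's English description precedes it below -/
import Mathlib

section
/- Let μ₀ > 0 and let r ≥ 1 be an integer. Let W, U ∈ ℝ^{m×r} and denote by W^{(i)}, U^{(i)} ∈ ℝ^r their i-th rows. Assume ‖U^{(i)}‖² ≤ 3μ₀r and ‖W^{(i)}‖² ≤ 4μ₀r for every i = 1,…,m. Then Σ_{i=1}^m G₁(‖W^{(i)}‖²/(3μ₀r)) ≤ (14·e^{1/9}/(9μ₀r))·‖W − U‖_F². -/
open Matrix

/-- Frobenius norm of a real matrix. -/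
noncomputable def frobNorm {m n : ℕ} (A : Matrix (Fin m) (Fin n) ℝ) : ℝ :=
  Real.sqrt (∑ i, ∑ j, (A i j) ^ 2)

/-- The penalty function `G₁`. -/
noncomputable def G1 (z : ℝ) : ℝ := if z ≤ 1 then 0 else Real.exp ((z - 1) ^ 2) - 1

/-- The squared distance of two vectors controls the squared difference of their squared norms. -/
lemma sq_sum_sq_sub_sum_sq_le {ι : Type*} (s : Finset ι) (w u : ι → ℝ) :
    (∑ j ∈ s, w j ^ 2 - ∑ j ∈ s, u j ^ 2) ^ 2
      ≤ (∑ j ∈ s, (w j - u j) ^ 2) * (2 * (∑ j ∈ s, w j ^ 2 + ∑ j ∈ s, u j ^ 2)) := by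
  have hfactor : ∑ j ∈ s, w j ^ 2 - ∑ j ∈ s, u j ^ 2 = ∑ j ∈ s, (w j - u j) * (w j + u j) := by
    rw [← Finset.sum_sub_distrib]
    exact Finset.sum_congr rfl fun j _ => by ring
  rw [hfactor]
  refine (Finset.sum_mul_sq_le_sq_mul_sq s _ _).trans ?_
  refine mul_le_mul_of_nonneg_left ?_ (Finset.sum_nonneg fun j _ => sq_nonneg _)
  rw [← Finset.sum_add_distrib, Finset.mul_sum]
  exact Finset.sum_le_sum fun j _ => by nlinarith [sq_nonneg (w j - u j)]

lemma G1_le_of_le_four_thirds {z : ℝ} (h1 : 1 < z) (hz : z ≤ 4 / 3) :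
    G1 z ≤ Real.exp (1 / 9) * (z - 1) ^ 2 := by
  rw [G1, if_neg h1.not_ge]
  set x := (z - 1) ^ 2 with hx
  have hx9 : x ≤ 1 / 9 := by nlinarith
  have hneg := mul_le_mul_of_nonneg_left (Real.add_one_le_exp (-x)) (Real.exp_pos x).le
  rw [← Real.exp_add, add_neg_cancel, Real.exp_zero] at hneg
  have hexp := mul_le_mul_of_nonneg_right (Real.exp_le_exp.mpr hx9) (sq_nonneg (z - 1))
  rw [← hx] at hexp
  linarith

lemma G1_sum_sq_div_le {ι : Type*} (s : Finset ι) (w u : ι → ℝ) {c : ℝ} (hc : 0 < c)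
    (hu : ∑ j ∈ s, u j ^ 2 ≤ c) (hw : ∑ j ∈ s, w j ^ 2 ≤ 4 / 3 * c) :
    G1 ((∑ j ∈ s, w j ^ 2) / c)
      ≤ 14 * Real.exp (1 / 9) / (3 * c) * ∑ j ∈ s, (w j - u j) ^ 2 := by
  have hdiff := sq_sum_sq_sub_sum_sq_le s w u
  have hD : 0 ≤ ∑ j ∈ s, (w j - u j) ^ 2 := Finset.sum_nonneg fun j _ => sq_nonneg _
  set A := ∑ j ∈ s, w j ^ 2
  set B := ∑ j ∈ s, u j ^ 2
  set D := ∑ j ∈ s, (w j - u j) ^ 2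
  rcases le_or_gt (A / c) 1 with h | h
  · rw [G1, if_pos h]
    positivity
  have hcA : c < A := by rwa [one_lt_div hc] at h
  have hsq : (A - c) ^ 2 ≤ 14 / 3 * c * D := by
    calc (A - c) ^ 2 ≤ (A - B) ^ 2 := by gcongr
      _ ≤ D * (2 * (A + B)) := hdiff
      _ ≤ D * (14 / 3 * c) := mul_le_mul_of_nonneg_left (by linarith) hD
      _ = 14 / 3 * c * D := by ring
  calc G1 (A / c) ≤ Real.exp (1 / 9) * (A / c - 1) ^ 2 :=
        G1_le_of_le_four_thirds h ((div_le_iff₀ hc).mpr hw)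
    _ = Real.exp (1 / 9) * ((A - c) ^ 2 / c ^ 2) := by field_simp
    _ ≤ Real.exp (1 / 9) * (14 / 3 * c * D / c ^ 2) := by gcongr
    _ = 14 * Real.exp (1 / 9) / (3 * c) * D := by field_simp

/-- bound on the sum of penalties by the Frobenius distance. -/
theorem stmt_17 {m r : ℕ} (hr : 1 ≤ r) (μ₀ : ℝ) (hμ₀ : 0 < μ₀)
    (W U : Matrix (Fin m) (Fin r) ℝ)
    (hU : ∀ i, ∑ j, (U i j) ^ 2 ≤ 3 * μ₀ * r)
    (hW : ∀ i, ∑ j, (W i j) ^ 2 ≤ 4 * μ₀ * r) :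
    ∑ i, G1 ((∑ j, (W i j) ^ 2) / (3 * μ₀ * r))
      ≤ (14 * Real.exp (1 / 9) / (9 * μ₀ * r)) * frobNorm (W - U) ^ 2 := by
  have hc : 0 < 3 * μ₀ * r := by
    have : (0 : ℝ) < r := by exact_mod_cast hr
    positivity
  have hfrob : frobNorm (W - U) ^ 2 = ∑ i, ∑ j, (W i j - U i j) ^ 2 :=
    Real.sq_sqrt (Finset.sum_nonneg fun i _ => Finset.sum_nonneg fun j _ => sq_nonneg _)
  rw [hfrob, Finset.mul_sum]
  refine Finset.sum_le_sum fun i _ => ?_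
  have hrow := G1_sum_sq_div_le Finset.univ (W i) (U i) hc (hU i) (by linarith [hW i])
  rwa [show 3 * (3 * μ₀ * (r : ℝ)) = 9 * μ₀ * r by ring] at hrow
end

section
/- Let m ≥ n ≥ 1 and r ≥ 1 be integers. Let U, W ∈ ℝ^{m×r} with UᵀU = m·I_r and WᵀW = m·I_r, let V, Z ∈ ℝ^{n×r} with VᵀV = n·I_r and ZᵀZ = n·I_r, and let Σ ∈ ℝ^{r×r} be diagonal with all diagonal entries bounded in absolute value by Σ_max ≥ 0. Then (1/2)·‖UΣVᵀ − WΣZᵀ‖_F² ≤ m·Σ_max²·(‖U − W‖_F² + ‖V − Z‖_F²). -/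
open Matrix

theorem frobNorm_sq {m n : ℕ} (A : Matrix (Fin m) (Fin n) ℝ) :
    frobNorm A ^ 2 = ∑ i, ∑ j, A i j ^ 2 :=
  Real.sq_sqrt (Finset.sum_nonneg fun _ _ => Finset.sum_nonneg fun _ _ => sq_nonneg _)

theorem frobNorm_sq_eq_trace {m n : ℕ} (A : Matrix (Fin m) (Fin n) ℝ) :
    frobNorm A ^ 2 = (A * Aᵀ).trace := by
  rw [frobNorm_sq]
  simp [Matrix.trace, Matrix.mul_apply, sq]

theorem frobNorm_transpose {m n : ℕ} (A : Matrix (Fin m) (Fin n) ℝ) :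
    frobNorm Aᵀ = frobNorm A := by
  unfold frobNorm
  rw [Finset.sum_comm]
  rfl

theorem frobNorm_add_sq_le {m n : ℕ} (A B : Matrix (Fin m) (Fin n) ℝ) :
    frobNorm (A + B) ^ 2 ≤ 2 * (frobNorm A ^ 2 + frobNorm B ^ 2) := by
  simp only [frobNorm_sq, ← Finset.sum_add_distrib, Finset.mul_sum]
  exact Finset.sum_le_sum fun i _ => Finset.sum_le_sum fun j _ => add_sq_le

/-- Multiplying by the transpose of a matrix with orthogonal columns of squared length `c`
scales the squared Frobenius norm by `c`. -/
theorem frobNorm_mul_transpose_sq {k n r : ℕ} (A : Matrix (Fin k) (Fin r) ℝ)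
    {V : Matrix (Fin n) (Fin r) ℝ} {c : ℝ} (hV : Vᵀ * V = c • 1) :
    frobNorm (A * Vᵀ) ^ 2 = c * frobNorm A ^ 2 := by
  have h : A * Vᵀ * (A * Vᵀ)ᵀ = c • (A * Aᵀ) := by
    rw [transpose_mul, transpose_transpose, Matrix.mul_assoc, ← Matrix.mul_assoc Vᵀ, hV]
    simp
  rw [frobNorm_sq_eq_trace, frobNorm_sq_eq_trace, h, trace_smul, smul_eq_mul]

theorem frobNorm_mul_diagonal_sq_le {k r : ℕ} (A : Matrix (Fin k) (Fin r) ℝ)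
    {d : Fin r → ℝ} {b : ℝ} (hd : ∀ i, |d i| ≤ b) :
    frobNorm (A * diagonal d) ^ 2 ≤ b ^ 2 * frobNorm A ^ 2 := by
  simp only [frobNorm_sq, Finset.mul_sum, mul_diagonal]
  refine Finset.sum_le_sum fun i _ => Finset.sum_le_sum fun j _ => ?_
  rw [mul_pow, mul_comm]
  exact mul_le_mul_of_nonneg_right (sq_le_sq' (abs_le.mp (hd j)).1 (abs_le.mp (hd j)).2)
    (sq_nonneg _)

/-- bound `(1/2)‖UΣVᵀ − WΣZᵀ‖_F² ≤ m·Σ_max²·(‖U − W‖_F² + ‖V − Z‖_F²)`. -/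
theorem stmt_18 {m n r : ℕ} (hmn : n ≤ m) (hn : 1 ≤ n) (hr : 1 ≤ r)
    (U W : Matrix (Fin m) (Fin r) ℝ) (V Z : Matrix (Fin n) (Fin r) ℝ)
    (hU : Uᵀ * U = (m : ℝ) • 1) (hW : Wᵀ * W = (m : ℝ) • 1)
    (hV : Vᵀ * V = (n : ℝ) • 1) (hZ : Zᵀ * Z = (n : ℝ) • 1)
    (S : Matrix (Fin r) (Fin r) ℝ) (hS : S.IsDiag)
    (Smax : ℝ) (hSmax : 0 ≤ Smax) (hSbound : ∀ i, |S i i| ≤ Smax) :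
    (1 / 2) * frobNorm (U * S * Vᵀ - W * S * Zᵀ) ^ 2
      ≤ (m : ℝ) * Smax ^ 2 * (frobNorm (U - W) ^ 2 + frobNorm (V - Z) ^ 2) := by
  obtain ⟨d, rfl⟩ : ∃ d, S = diagonal d := ⟨S.diag, hS.diagonal_diag.symm⟩
  have hd : ∀ i, |d i| ≤ Smax := by simpa using hSbound
  have hsplit : U * diagonal d * Vᵀ - W * diagonal d * Zᵀ
      = (U - W) * diagonal d * Vᵀ + ((V - Z) * diagonal d * Wᵀ)ᵀ := by
    simp only [transpose_mul, transpose_transpose, diagonal_transpose, transpose_sub,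
      Matrix.sub_mul, Matrix.mul_assoc]
    abel
  have hadd := frobNorm_add_sq_le ((U - W) * diagonal d * Vᵀ) ((V - Z) * diagonal d * Wᵀ)ᵀ
  rw [← hsplit, frobNorm_transpose, frobNorm_mul_transpose_sq _ hV,
    frobNorm_mul_transpose_sq _ hW] at hadd
  have hleft : (n : ℝ) * frobNorm ((U - W) * diagonal d) ^ 2
      ≤ m * (Smax ^ 2 * frobNorm (U - W) ^ 2) := by
    gcongr
    exact frobNorm_mul_diagonal_sq_le _ hd
  have hright : (m : ℝ) * frobNorm ((V - Z) * diagonal d) ^ 2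
      ≤ m * (Smax ^ 2 * frobNorm (V - Z) ^ 2) := by
    gcongr
    exact frobNorm_mul_diagonal_sq_le _ hd
  linarith
end
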